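/- For integers 0 ≤ n < m, define ε̄(n, m) = sup{ε ∈ [0, 1/2] : for every u_0 ∈ ℝ^m and every α ∈ ℝ^m all of whose coordinates are nonzero and with dim_ℚ(α) ≥ m − n, the set {u_0 + tα : t ∈ ℝ} + ℤ^m has nonempty intersection with the cube [ε, 1−ε]^m}. Then ε̄(n, m) = 1/(2(n+1)). -/

import Mathlib

/-- `ε̄(n, m)`: the supremum of all `ε ∈ [0, 1/2]` such that for every `u₀ ∈ ℝ^m`
and every `α ∈ ℝ^m` with all coordinates nonzero and `dim_ℚ(α) ≥ m - n`, the set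
`{u₀ + tα : t ∈ ℝ} + ℤ^m` meets the cube `[ε, 1-ε]^m`. -/
noncomputable def epsBar (n m : ℕ) : ℝ :=
  sSup {ε : ℝ | 0 ≤ ε ∧ ε ≤ 1 / 2 ∧
    ∀ u₀ α : Fin m → ℝ, (∀ i, α i ≠ 0) →
      m - n ≤ Module.finrank ℚ (Submodule.span ℚ (Set.range α)) →
      ∃ (t : ℝ) (k : Fin m → ℤ), ∀ i,
        ε ≤ u₀ i + t * α i + (k i : ℝ) ∧ u₀ i + t * α i + (k i : ℝ) ≤ 1 - ε}

open MeasureTheory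

namespace ContinuousMap

lemma integrable_of_compactSpace {X : Type*} [TopologicalSpace X] [CompactSpace X]
    [MeasurableSpace X] [BorelSpace X] (ρ : Measure X) [IsFiniteMeasure ρ] (f : C(X, ℂ)) :
    Integrable f ρ :=
  f.continuous.integrable_of_hasCompactSupport (HasCompactSupport.of_compactSpace f)

lemma continuous_integral {X : Type*} [TopologicalSpace X] [CompactSpace X]
    [MeasurableSpace X] [BorelSpace X] (ρ : Measure X) [IsFiniteMeasure ρ] :
    Continuous fun f : C(X, ℂ) ↦ ∫ x, f x ∂ρ := by
  refine (LipschitzWith.of_dist_le_mul (K := (ρ.real Set.univ).toNNReal) fun f g ↦ ?_).continuous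
  rw [dist_eq_norm, dist_eq_norm,
    ← integral_sub (integrable_of_compactSpace ρ f) (integrable_of_compactSpace ρ g),
    Real.coe_toNNReal _ measureReal_nonneg, mul_comm]
  exact norm_integral_le_of_norm_le_const (.of_forall fun x ↦ (f - g).norm_coe_le_norm x)

end ContinuousMap

namespace UnitAddTorus
variable {d : Type*} [Fintype d]

lemma mFourier_add_apply (n : d → ℤ) (x y : UnitAddTorus d) :
    mFourier n (x + y) = mFourier n x * mFourier n y := by
  simp only [mFourier, ContinuousMap.coe_mk, Pi.add_apply, fourier_apply, smul_add,
    AddCircle.toCircle_add, Circle.coe_mul, Finset.prod_mul_distrib]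

lemma mFourier_mul_coe (n : d → ℤ) (γ : d → ℝ) (t : ℝ) :
    mFourier n (fun j ↦ ((t * γ j : ℝ) : UnitAddCircle)) =
      Complex.exp (2 * Real.pi * Complex.I * (t * ∑ j, n j * γ j : ℝ)) := by
  simp only [mFourier, ContinuousMap.coe_mk, fourier_coe_apply, ← Complex.exp_sum]
  congr 1
  push_cast
  simp only [Finset.mul_sum]
  exact Finset.sum_congr rfl fun j _ ↦ by ring

/-- A continuous homomorphism from a compact group to a torus, along which every nontrivial
monomial takes the value `-1`, pushes the Haar measure to one with the trivial Fourier
coefficients. -/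
lemma integral_mFourier_comp {H : Type*} [AddGroup H] [TopologicalSpace H]
    [IsTopologicalAddGroup H] [MeasurableSpace H] [BorelSpace H] (ν : Measure H)
    [ν.IsAddLeftInvariant] [IsProbabilityMeasure ν] (φ : H →+ UnitAddTorus d) {n : d → ℤ}
    (hn : n ≠ 0 → ∃ h, mFourier n (φ h) = -1) :
    ∫ h, mFourier n (φ h) ∂ν = if n = 0 then 1 else 0 := by
  split_ifs with h0
  · simp [h0, mFourier_zero]
  · obtain ⟨h, hh⟩ := hn h0
    refine integral_eq_zero_of_add_left_eq_neg (g := h) fun x ↦ ?_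
    rw [map_add, mFourier_add_apply, hh, neg_one_mul]

lemma integral_comp_eq_of_mFourier {H : Type*} [TopologicalSpace H] [CompactSpace H]
    [MeasurableSpace H] [BorelSpace H] (ν : Measure H) [IsFiniteMeasure ν]
    (φ : C(H, UnitAddTorus d)) (μ : Measure (UnitAddTorus d)) [IsFiniteMeasure μ]
    (h : ∀ n : d → ℤ, ∫ x, mFourier n (φ x) ∂ν = ∫ x, mFourier n x ∂μ)
    (f : C(UnitAddTorus d, ℂ)) : ∫ x, f (φ x) ∂ν = ∫ x, f x ∂μ := by
  have hf : f ∈ (Submodule.span ℂ (Set.range (mFourier (d := d)))).topologicalClosure := by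
    rw [span_mFourier_closure_eq_top]; trivial
  refine closure_minimal (t := {g : C(UnitAddTorus d, ℂ) | ∫ x, g (φ x) ∂ν = ∫ x, g x ∂μ})
    (fun g hg ↦ ?_) ?_ hf
  · induction hg using Submodule.span_induction with
    | mem g hg => obtain ⟨n, rfl⟩ := hg; exact h n
    | zero => simp
    | add a b _ _ ha hb =>
      exact (integral_add (ContinuousMap.integrable_of_compactSpace ν (a.comp φ))
        (ContinuousMap.integrable_of_compactSpace ν (b.comp φ))).trans
        ((congrArg₂ (· + ·) ha hb).trans (integral_add
          (ContinuousMap.integrable_of_compactSpace μ a)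
          (ContinuousMap.integrable_of_compactSpace μ b)).symm)
    | smul c a _ ha =>
      simp only [Set.mem_ofPred_eq, ContinuousMap.smul_apply, integral_smul] at ha ⊢
      rw [ha]
  · exact isClosed_eq ((ContinuousMap.continuous_integral ν).comp φ.continuous_precomp)
      (ContinuousMap.continuous_integral μ)

/-- **Kronecker's theorem**: a line whose direction has rationally independent coordinates is
dense in the torus. -/
theorem denseRange_mul_coe (γ : d → ℝ) (hγ : LinearIndependent ℚ γ) :
    DenseRange fun (t : ℝ) (j : d) ↦ ((t * γ j : ℝ) : UnitAddCircle) := by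
  let g : ℝ →+ UnitAddTorus d :=
    { toFun := fun t j ↦ ((t * γ j : ℝ) : UnitAddCircle)
      map_zero' := by ext; simp
      map_add' := fun s t ↦ by ext j; simp [add_mul] }
  have hneg : ∀ n : d → ℤ, n ≠ 0 → ∃ t, mFourier n (g t) = -1 := by
    intro n hn
    have hc : ∑ j, n j * γ j ≠ 0 := by
      intro h0
      refine hn (funext fun j ↦ ?_)
      have := Fintype.linearIndependent_iff.1 hγ (fun j ↦ (n j : ℚ)) (by
        simpa [Rat.smul_def] using h0) j
      exact_mod_cast this
    refine ⟨1 / (2 * ∑ j, n j * γ j), (mFourier_mul_coe _ _ _).trans ?_⟩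
    rw [← Complex.exp_pi_mul_I]
    congr 1
    rw [show 1 / (2 * ∑ j, n j * γ j) * ∑ j, n j * γ j = 1 / 2 by field_simp]
    push_cast; ring
  let G : AddSubgroup (UnitAddTorus d) := g.range.topologicalClosure
  have hG : IsClosed (G : Set (UnitAddTorus d)) := g.range.isClosed_topologicalClosure
  have : CompactSpace G := isCompact_iff_compactSpace.1 hG.isCompact
  have hgG : ∀ t, g t ∈ G := fun t ↦ g.range.le_topologicalClosure ⟨t, rfl⟩
  suffices h : (G : Set (UnitAddTorus d)) = Set.univ by
    intro y
    have : y ∈ (G : Set (UnitAddTorus d)) := h ▸ Set.mem_univ y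
    exact this
  let ν : Measure G := Measure.addHaarMeasure ⊤
  let μ : Measure (UnitAddTorus d) := Measure.addHaarMeasure ⊤
  have hν : IsProbabilityMeasure ν := ⟨by
    simpa using Measure.addHaarMeasure_self (K₀ := (⊤ : TopologicalSpace.PositiveCompacts G))⟩
  have hμ : IsProbabilityMeasure μ := ⟨by
    simpa using Measure.addHaarMeasure_self
      (K₀ := (⊤ : TopologicalSpace.PositiveCompacts (UnitAddTorus d)))⟩
  by_contra hne
  obtain ⟨y, hy⟩ := (Set.ne_univ_iff_exists_notMem _).1 hne
  let f : C(UnitAddTorus d, ℝ) := ⟨fun x ↦ Metric.infDist x G, Metric.continuous_infDist_pt _⟩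
  let fc : C(UnitAddTorus d, ℂ) := ⟨fun x ↦ (f x : ℂ), by fun_prop⟩
  have heq := integral_comp_eq_of_mFourier ν ⟨Subtype.val, continuous_subtype_val⟩ μ
    (fun n ↦ (integral_mFourier_comp ν G.subtype
      (fun h ↦ (hneg n h).imp' (fun t ↦ ⟨g t, hgG t⟩) fun t ht ↦ ht)).trans
      (integral_mFourier_comp μ (AddMonoidHom.id _)
      (fun h ↦ (hneg n h).imp' g fun t ht ↦ ht)).symm) fc
  have h0 : ∫ x : G, fc x ∂ν = 0 := by
    simp [fc, f, Metric.infDist_zero_of_mem]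
  have h1 : 0 < ∫ x, f x ∂μ :=
    f.continuous.integral_pos_of_hasCompactSupport_nonneg_nonzero
      (HasCompactSupport.of_compactSpace f) (fun x ↦ Metric.infDist_nonneg)
      (x := y) (by
        have := (hG.notMem_iff_infDist_pos ⟨_, G.zero_mem⟩).1 hy
        exact this.ne')
  have h2 : ∫ x, fc x ∂μ = ((∫ x, f x ∂μ : ℝ) : ℂ) := integral_ofReal
  rw [h2] at heq
  have : ((∫ x, f x ∂μ : ℝ) : ℂ) = 0 := heq.symm.trans h0
  exact h1.ne' (by exact_mod_cast this)

end UnitAddTorus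

lemma measurePreserving_add_zsmul (c : UnitAddCircle) {a : ℤ} (ha : a ≠ 0) :
    MeasurePreserving (fun x : UnitAddCircle ↦ c + a • x) := by
  rcases lt_or_ge 1 |a| with h | h
  · simpa [add_comm] using (AddCircle.ergodic_zsmul_add (T := 1) c h).toMeasurePreserving
  · have : a = 1 ∨ a = -1 := by
      have := abs_pos.2 ha
      rcases abs_cases a with h' | h' <;> omega
    rcases this with rfl | rfl
    · simpa using measurePreserving_add_left (volume : Measure UnitAddCircle) c
    · simpa [sub_eq_add_neg] using
        Measure.measurePreserving_sub_left (volume : Measure UnitAddCircle) c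

/-- Finitely many translated multiples of a point of the circle can be kept at distance more than
`ε` from zero as soon as the obstructing intervals have total length less than one. -/
lemma exists_forall_lt_norm_add_zsmul {ι : Type*} (s : Finset ι) (c : ι → UnitAddCircle)
    (a : ι → ℤ) (ha : ∀ i ∈ s, a i ≠ 0) {ε : ℝ} (hs : s.card * (2 * ε) < 1) :
    ∃ x : UnitAddCircle, ∀ i ∈ s, ε < ‖c i + a i • x‖ := by
  let B : ι → Set UnitAddCircle := fun i ↦ (fun x ↦ c i + a i • x) ⁻¹' Metric.closedBall 0 ε
  have hB : ∀ i ∈ s, volume (B i) ≤ ENNReal.ofReal (2 * ε) := by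
    intro i hi
    rw [(measurePreserving_add_zsmul (c i) (ha i hi)).measure_preimage
      measurableSet_closedBall.nullMeasurableSet, AddCircle.volume_closedBall]
    exact ENNReal.ofReal_le_ofReal (min_le_right _ _)
  have hlt : volume (⋃ i ∈ s, B i) < 1 := by
    calc volume (⋃ i ∈ s, B i) ≤ ∑ i ∈ s, volume (B i) := measure_biUnion_finset_le _ _
      _ ≤ ∑ _i ∈ s, ENNReal.ofReal (2 * ε) := Finset.sum_le_sum hB
      _ = ENNReal.ofReal (s.card * (2 * ε)) := by
        rw [Finset.sum_const, nsmul_eq_mul, ENNReal.ofReal_mul (Nat.cast_nonneg s.card),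
          ENNReal.ofReal_natCast]
      _ < 1 := by rwa [← ENNReal.ofReal_one, ENNReal.ofReal_lt_ofReal_iff one_pos]
  have hne : (⋃ i ∈ s, B i) ≠ Set.univ := by
    intro h
    rw [h, UnitAddCircle.measure_univ] at hlt
    exact lt_irrefl _ hlt
  obtain ⟨x, hx⟩ := (Set.ne_univ_iff_exists_notMem _).1 hne
  refine ⟨x, fun i hi ↦ ?_⟩
  simp only [Set.mem_iUnion, not_exists] at hx
  simpa [B] using hx i hi

/-- Choosing the coordinates one after the other, it suffices to control, for each `j`, the number
of integral forms whose last nonzero coefficient is the `j`-th one. -/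
lemma exists_forall_lt_norm_add_sum_zsmul {ι : Type*} [Fintype ι] {r : ℕ} (u : ι → UnitAddCircle)
    (a : ι → Fin r → ℤ) (top : ι → Fin r) (htop : ∀ i, a i (top i) ≠ 0)
    (hlast : ∀ i j, top i < j → a i j = 0) {ε : ℝ}
    (hcard : ∀ j, (Finset.univ.filter fun i ↦ top i = j).card * (2 * ε) < 1) :
    ∃ y : Fin r → UnitAddCircle, ∀ i, ε < ‖u i + ∑ j, a i j • y j‖ := by
  suffices h : ∀ k ≤ r, ∃ y : Fin r → UnitAddCircle, ∀ i, (top i : ℕ) < k →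
      ε < ‖u i + ∑ j, a i j • y j‖ by
    obtain ⟨y, hy⟩ := h r le_rfl
    exact ⟨y, fun i ↦ hy i (top i).2⟩
  intro k
  induction k with
  | zero => exact fun _ ↦ ⟨0, fun i hi ↦ absurd hi (Nat.not_lt_zero _)⟩
  | succ k ih =>
    intro hk
    obtain ⟨y, hy⟩ := ih (by omega)
    let κ : Fin r := ⟨k, hk⟩
    have hsum : ∀ i x, ∑ j, a i j • Function.update y κ x j =
        (∑ j ∈ Finset.univ.erase κ, a i j • y j) + a i κ • x := by
      intro i x
      rw [← Finset.sum_erase_add _ _ (Finset.mem_univ κ), Function.update_self]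
      congr 1
      refine Finset.sum_congr rfl fun j hj ↦ ?_
      rw [Function.update_of_ne (Finset.ne_of_mem_erase hj)]
    obtain ⟨x, hx⟩ := exists_forall_lt_norm_add_zsmul
      (Finset.univ.filter fun i ↦ top i = κ)
      (fun i ↦ u i + ∑ j ∈ Finset.univ.erase κ, a i j • y j) (fun i ↦ a i κ)
      (fun i hi ↦ (Finset.mem_filter.1 hi).2 ▸ htop i) (hcard κ)
    refine ⟨Function.update y κ x, fun i hi ↦ ?_⟩
    rw [hsum]
    rcases Nat.lt_succ_iff_lt_or_eq.1 hi with h | h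
    · have h0 : a i κ = 0 := hlast i κ h
      have := hy i h
      rw [← Finset.sum_erase_add _ _ (Finset.mem_univ κ), h0] at this
      simpa [h0] using this
    · rw [← add_assoc]
      exact hx i (Finset.mem_filter.2 ⟨Finset.mem_univ _, Fin.ext h⟩)

lemma exists_int_of_lt_norm_coe {x ε : ℝ} (h : ε < ‖(x : UnitAddCircle)‖) :
    ∃ k : ℤ, ε ≤ x + k ∧ x + k ≤ 1 - ε := by
  rw [UnitAddCircle.norm_eq, abs_sub_round_eq_min, lt_min_iff] at h
  refine ⟨-⌊x⌋, ?_⟩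
  have : x + ((-⌊x⌋ : ℤ) : ℝ) = Int.fract x := by rw [Int.fract]; push_cast; ring
  rw [this]
  constructor <;> linarith [h.1, h.2]

/-- A finite family in a `ℚ`-vector space consists of integral combinations of a rescaled
basis extracted from it. -/
lemma exists_linearIndependent_int_combination {ι V : Type*} [Finite ι] [AddCommGroup V]
    [Module ℚ V] (α : ι → V) {r : ℕ} (hr : Module.finrank ℚ (Submodule.span ℚ (Set.range α)) = r) :
    ∃ (γ : Fin r → V) (a : ι → Fin r → ℤ) (s : Fin r → ι), LinearIndependent ℚ γ ∧
      (∀ i, α i = ∑ j, a i j • γ j) ∧ ∀ j j', a (s j) j' ≠ 0 ↔ j' = j := by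
  subst hr
  have : Module.Finite ℚ (Submodule.span ℚ (Set.range α)) :=
    Module.Finite.span_of_finite ℚ (Set.finite_range α)
  obtain ⟨β, hβmem, hspan, hβ⟩ := Submodule.exists_fun_fin_finrank_span_eq ℚ (Set.range α)
  choose s hs using hβmem
  have hq : ∀ i, ∃ q : _ → ℚ, ∑ j, q j • β j = α i := by
    intro i
    rw [← Submodule.mem_span_range_iff_exists_fun, hspan]
    exact Submodule.subset_span ⟨i, rfl⟩
  choose q hq using hq
  obtain ⟨⟨N, hN⟩, hN'⟩ := IsLocalization.exist_integer_multiples_of_finite (nonZeroDivisors ℤ)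
    (fun p : ι × Fin _ ↦ q p.1 p.2)
  have hN0 : (N : ℚ) ≠ 0 := by exact_mod_cast nonZeroDivisors.ne_zero hN
  choose a ha using hN'
  have ha' : ∀ i j, (a (i, j) : ℚ) = N * q i j := fun i j ↦ by simpa using ha (i, j)
  refine ⟨fun j ↦ (N : ℚ)⁻¹ • β j, fun i j ↦ a (i, j), s, ?_, ?_, ?_⟩
  · exact hβ.units_smul (fun _ ↦ (Units.mk0 (N : ℚ) hN0)⁻¹)
  · intro i
    rw [← hq i]
    refine Finset.sum_congr rfl fun j _ ↦ ?_
    rw [← Int.cast_smul_eq_zsmul ℚ, ha', smul_smul]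
    congr 1
    field_simp
  · intro j j'
    have hqs : q (s j) = Pi.single j 1 := by
      refine (Fintype.linearIndependent_iffₛ.1 hβ) _ _ ?_ |> funext
      rw [hq, hs]
      simp [Pi.single_apply, ite_smul]
    have := ha' (s j) j'
    rw [hqs] at this
    rw [← Int.cast_ne_zero (α := ℚ), this]
    simp [hN0, Pi.single_apply]

/-- The lower bound: a line whose direction spans a rational space of large dimension, with
nonzero coordinates, meets every cube with `ε < 1 / (2 * (n + 1))`. -/
lemma exists_mem_cube {n m : ℕ} (hnm : n < m) {ε : ℝ} (hε0 : 0 ≤ ε)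
    (hε : ε < 1 / (2 * (n + 1))) (u α : Fin m → ℝ) (hα : ∀ i, α i ≠ 0)
    (hdim : m - n ≤ Module.finrank ℚ (Submodule.span ℚ (Set.range α))) :
    ∃ (t : ℝ) (k : Fin m → ℤ), ∀ i,
      ε ≤ u i + t * α i + (k i : ℝ) ∧ u i + t * α i + (k i : ℝ) ≤ 1 - ε := by
  obtain ⟨r, hr⟩ : ∃ r, Module.finrank ℚ (Submodule.span ℚ (Set.range α)) = r := ⟨_, rfl⟩
  rw [hr] at hdim
  obtain ⟨γ, a, s, hγ, hαγ, hs⟩ := exists_linearIndependent_int_combination α hr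
  have hne : ∀ i, (Finset.univ.filter fun j ↦ a i j ≠ 0).Nonempty := by
    intro i
    by_contra h
    rw [Finset.not_nonempty_iff_eq_empty, Finset.filter_eq_empty_iff] at h
    refine hα i ((hαγ i).trans (Finset.sum_eq_zero fun j hj ↦ ?_))
    rw [not_not.1 (h hj), zero_smul]
  let top : Fin m → Fin r := fun i ↦ (Finset.univ.filter fun j ↦ a i j ≠ 0).max' (hne i)
  have htop : ∀ i, a i (top i) ≠ 0 := fun i ↦
    (Finset.mem_filter.1 (Finset.max'_mem _ (hne i))).2
  have hlast : ∀ i j, top i < j → a i j = 0 := by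
    intro i j hij
    by_contra h
    exact absurd (Finset.le_max' _ j (Finset.mem_filter.2 ⟨Finset.mem_univ _, h⟩)) hij.not_ge
  have htops : ∀ j, top (s j) = j := fun j ↦ (hs j _).1 (htop (s j))
  have hcard : ∀ j, (Finset.univ.filter fun i ↦ top i = j).card ≤ n + 1 := by
    intro j
    have hsum := Finset.card_eq_sum_card_fiberwise (f := top) (s := Finset.univ)
      (t := Finset.univ) (fun _ _ ↦ Finset.mem_coe.2 (Finset.mem_univ _))
    rw [← Finset.add_sum_erase _ _ (Finset.mem_univ j), Finset.card_fin] at hsum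
    have hge := Finset.card_nsmul_le_sum (Finset.univ.erase j)
      (fun j ↦ (Finset.univ.filter fun i ↦ top i = j).card) 1 fun j' _ ↦
        Finset.card_pos.2 ⟨s j', Finset.mem_filter.2 ⟨Finset.mem_univ _, htops j'⟩⟩
    rw [Finset.card_erase_of_mem (Finset.mem_univ j), Finset.card_fin, smul_eq_mul] at hge
    omega
  obtain ⟨y, hy⟩ := exists_forall_lt_norm_add_sum_zsmul (fun i ↦ (u i : UnitAddCircle)) a top htop
    hlast (ε := ε) fun j ↦ by
      rw [lt_div_iff₀ (by positivity)] at hε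
      have : ((Finset.univ.filter fun i ↦ top i = j).card : ℝ) ≤ n + 1 := by
        exact_mod_cast hcard j
      nlinarith
  have hopen : IsOpen {y : UnitAddTorus (Fin r) |
      ∀ i, ε < ‖(u i : UnitAddCircle) + ∑ j, a i j • y j‖} := by
    rw [Set.ofPred_forall]
    exact isOpen_iInter_of_finite fun i ↦ isOpen_lt (by fun_prop) (by fun_prop)
  obtain ⟨t, ht⟩ := (UnitAddTorus.denseRange_mul_coe γ hγ).exists_mem_open hopen ⟨y, hy⟩
  have hk : ∀ i, ∃ k : ℤ, ε ≤ u i + t * α i + k ∧ u i + t * α i + k ≤ 1 - ε := by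
    intro i
    refine exists_int_of_lt_norm_coe ((ht i).trans_eq ?_)
    rw [hαγ i, Finset.mul_sum, AddCircle.coe_add, ← QuotientAddGroup.mk'_apply _ (∑ j, _), map_sum]
    congr 2
    refine Finset.sum_congr rfl fun j _ ↦ ?_
    rw [mul_smul_comm, map_zsmul]
    rfl
  choose k hk using hk
  exact ⟨t, k, hk⟩

/-- Equally spaced translates of a point of the circle come close to zero. -/
lemma exists_abs_add_div_sub_le (n : ℕ) (x : ℝ) :
    ∃ i ≤ n, ∃ l : ℤ, |x + i / (n + 1) - l| ≤ 1 / (2 * (n + 1)) := by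
  have hn : (0 : ℝ) < n + 1 := by positivity
  let p := round ((n + 1) * x)
  have hp : |(n + 1) * x - p| ≤ 1 / 2 := abs_sub_round _
  have h0 := Int.emod_nonneg (-p) (show (n + 1 : ℤ) ≠ 0 by omega)
  have h1 := Int.emod_lt_of_pos (-p) (show (0 : ℤ) < n + 1 by omega)
  have h2 := Int.emod_add_mul_ediv (-p) (n + 1)
  obtain ⟨i, hi⟩ := Int.eq_ofNat_of_zero_le h0
  rw [hi] at h1 h2
  refine ⟨i, by omega, -(-p / (n + 1)), ?_⟩
  have h3 : (i : ℝ) + (n + 1) * ((-p / (n + 1) : ℤ) : ℝ) = -p := by exact_mod_cast h2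
  have h4 : x + i / (n + 1) - ((-(-p / (n + 1)) : ℤ) : ℝ) = ((n + 1) * x - p) / (n + 1) := by
    rw [eq_div_iff hn.ne']
    push_cast at h3 ⊢
    field_simp
    linarith
  rw [h4, abs_div, abs_of_pos hn, div_le_iff₀ hn]
  refine hp.trans_eq ?_
  field_simp

lemma exists_rat_linearIndependent_real (r : ℕ) : ∃ b : Fin r → ℝ, LinearIndependent ℚ b :=
  Module.le_rank_iff.1 (by rw [Real.rank_rat_real]; exact (Cardinal.nat_lt_continuum r).le)

/-- The upper bound: a line in a direction with `n + 1` equal coordinates, starting at a point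
whose corresponding coordinates are equally spaced, misses larger cubes. -/
lemma exists_line_forall_mem_cube_le {n m : ℕ} (hnm : n < m) :
    ∃ u α : Fin m → ℝ, (∀ i, α i ≠ 0) ∧
      m - n ≤ Module.finrank ℚ (Submodule.span ℚ (Set.range α)) ∧
      ∀ (ε t : ℝ) (k : Fin m → ℤ), (∀ i,
        ε ≤ u i + t * α i + (k i : ℝ) ∧ u i + t * α i + (k i : ℝ) ≤ 1 - ε) →
        ε ≤ 1 / (2 * (n + 1)) := by
  obtain ⟨b, hb⟩ := exists_rat_linearIndependent_real (m - n)
  let α : Fin m → ℝ := fun i ↦ b ⟨i - n, by omega⟩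
  have hrange : Set.range α = Set.range b := by
    refine Set.Subset.antisymm (Set.range_subset_iff.2 fun i ↦ ⟨_, rfl⟩)
      (Set.range_subset_iff.2 fun j ↦ ⟨⟨j + n, by omega⟩, ?_⟩)
    simp [α]
  refine ⟨fun i ↦ (i : ℕ) / (n + 1), α, fun i ↦ hb.ne_zero _, ?_, fun ε t k h ↦ ?_⟩
  · rw [hrange, finrank_span_eq_card hb, Fintype.card_fin]
  · obtain ⟨i, hi, l, hl⟩ := exists_abs_add_div_sub_le n (t * b ⟨0, by omega⟩)
    have hα : α ⟨i, by omega⟩ = b ⟨0, by omega⟩ := by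
      simp only [α]
      congr 2
      omega
    obtain ⟨h1, h2⟩ := h ⟨i, by omega⟩
    rw [hα] at h1 h2
    dsimp only at h1 h2
    rw [abs_le] at hl
    rcases le_or_gt (l + k ⟨i, by omega⟩) 0 with h0 | h0
    · have : (l : ℝ) + k ⟨i, by omega⟩ ≤ 0 := by exact_mod_cast h0
      linarith [hl.2]
    · have : (1 : ℝ) ≤ l + k ⟨i, by omega⟩ := by exact_mod_cast h0
      linarith [hl.1]

/-- For `0 ≤ n < m`, `ε̄(n, m) = 1/(2(n+1))`. -/
theorem stmt15 (n m : ℕ) (hnm : n < m) : epsBar n m = 1 / (2 * (n + 1)) := by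
  have hhalf : (1 : ℝ) / (2 * (n + 1)) ≤ 1 / 2 :=
    one_div_le_one_div_of_le two_pos (by linarith [(Nat.cast_nonneg n : (0 : ℝ) ≤ n)])
  have hpos : (0 : ℝ) < 1 / (2 * (n + 1)) := by positivity
  obtain ⟨u, α, hα, hdim, hle⟩ := exists_line_forall_mem_cube_le hnm
  refine csSup_eq_of_forall_le_of_forall_lt_exists_gt ?_ ?_ ?_
  · exact ⟨0, le_rfl, by norm_num, fun u α hα hdim ↦ exists_mem_cube hnm le_rfl hpos u α hα hdim⟩
  · rintro ε ⟨-, -, h⟩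
    obtain ⟨t, k, hk⟩ := h u α hα hdim
    exact hle ε t k hk
  · intro w hw
    obtain ⟨ε, hε, hε'⟩ := exists_between (max_lt hw hpos)
    have hε0 : 0 ≤ ε := (le_max_right _ _).trans hε.le
    exact ⟨ε, ⟨hε0, hε'.le.trans hhalf, fun u α hα hdim ↦
      exists_mem_cube hnm hε0 hε' u α hα hdim⟩, (le_max_left _ _).trans_lt hε⟩
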